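/- arXiv:1604.05698 — 5 statements merged into one kernel-verified Lean document; each statement's English description precedes it below -/
import Mathlib

section
/- Let $\varepsilon$ and $z$ be real quaternions with $\lVert \varepsilon \rVert < 1$ and $\lVert z \rVert = 1$. Then $\bar{\varepsilon} z + 1 \neq 0$ and $\lVert (z+\varepsilon)(\bar{\varepsilon} z + 1)^{-1} \rVert = 1$; that is, the quaternionic Möbius map $z \mapsto (z+\varepsilon)(\bar{\varepsilon} z + 1)^{-1}$ preserves the unit sphere $S^3$ of quaternions. -/
open Quaternion

theorem Quaternion.star_mul_add_one_of_norm_eq_one (ε : Quaternion ℝ) {z : Quaternion ℝ}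
    (hz : ‖z‖ = 1) : star ε * z + 1 = star (z + ε) * z := by
  have h : star z * z = 1 := by
    rw [Quaternion.star_mul_self, Quaternion.normSq_eq_norm_mul_self, hz]
    simp
  rw [star_add, add_mul, h, add_comm]

/-- The quaternionic boost Möbius map preserves the unit sphere `S³ ⊂ ℍ`. -/
theorem stmt_3 (ε z : Quaternion ℝ) (hε : ‖ε‖ < 1) (hz : ‖z‖ = 1) :
    star ε * z + 1 ≠ 0 ∧ ‖(z + ε) * (star ε * z + 1)⁻¹‖ = 1 := by
  have hne : z + ε ≠ 0 := by
    intro h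
    rw [eq_neg_of_add_eq_zero_left h, norm_neg] at hz
    exact hε.ne hz
  have hz0 : z ≠ 0 := norm_ne_zero_iff.mp (hz ▸ one_ne_zero)
  rw [Quaternion.star_mul_add_one_of_norm_eq_one ε hz]
  refine ⟨mul_ne_zero (star_ne_zero.mpr hne) hz0, ?_⟩
  rw [norm_mul, norm_inv, norm_mul, Quaternion.norm_star, hz, mul_one]
  exact mul_inv_cancel₀ (norm_ne_zero_iff.mpr hne)
end

section
/- Let $\varepsilon, \varphi$ be real quaternions with $\lVert\varepsilon\rVert < 1$ and $\lVert\varphi\rVert < 1$, and set $\sigma = (\varepsilon+\varphi)(1+\bar{\varepsilon}\varphi)^{-1}$ (note $1+\bar{\varepsilon}\varphi \neq 0$ and $1+\bar{\varphi}\varepsilon \neq 0$). Then the following identity of $2\times 2$ matrices over the quaternions holds: $\begin{pmatrix} 1 & \varphi \\ \bar{\varphi} & 1 \end{pmatrix} \begin{pmatrix} 1 & \varepsilon \\ \bar{\varepsilon} & 1 \end{pmatrix} = \begin{pmatrix} 1+\varphi\bar{\varepsilon} & 0 \\ 0 & 1+\bar{\varphi}\varepsilon \end{pmatrix} \begin{pmatrix}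 1 & \sigma \\ \bar{\sigma} & 1 \end{pmatrix}$, where $\bar{\sigma}$ is the quaternion conjugate of $\sigma$. -/
open Quaternion Matrix

/-- The quaternion `1 + star a * b` is nonzero whenever `a` and `b` lie in the
open unit ball. -/
theorem one_add_star_mul_ne_zero {a b : Quaternion ℝ} (ha : ‖a‖ < 1) (hb : ‖b‖ < 1) :
    1 + star a * b ≠ 0 := by
  intro h
  have h1 : ‖star a * b‖ = 1 := by
    rw [← neg_eq_of_add_eq_zero_right h, norm_neg, norm_one]
  rw [norm_mul, norm_star] at h1
  nlinarith [norm_nonneg a, norm_nonneg b]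

/-- The intertwining relation `(ε + φ)(1 + ε̄ φ) = (1 + φ ε̄)(ε + φ)`. -/
theorem add_mul_one_add_star_mul (ε φ : Quaternion ℝ) :
    (ε + φ) * (1 + star ε * φ) = (1 + φ * star ε) * (ε + φ) := by
  have h : ε * (star ε * φ) = φ * (star ε * ε) := by
    rw [← mul_assoc, Quaternion.self_mul_star, Quaternion.star_mul_self]
    exact Quaternion.coe_commutes _ _
  simp only [add_mul, mul_add, one_mul, mul_one, mul_assoc, h]
  abel

/-- The quaternionic "master equation" for composition of boosts. -/
theorem stmt_4 (ε φ : Quaternion ℝ) (hε : ‖ε‖ < 1) (hφ : ‖φ‖ < 1)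
    (σ : Quaternion ℝ) (hσ : σ = (ε + φ) * (1 + star ε * φ)⁻¹) :
    (!![1, φ; star φ, 1] * !![1, ε; star ε, 1]
      : Matrix (Fin 2) (Fin 2) (Quaternion ℝ))
      = !![1 + φ * star ε, 0; 0, 1 + star φ * ε] * !![1, σ; star σ, 1] := by
  have upper : (1 + φ * star ε) * σ = ε + φ := by
    rw [hσ, ← mul_assoc, ← add_mul_one_add_star_mul,
      mul_inv_cancel_right₀ (one_add_star_mul_ne_zero hε hφ)]
  have lower : (1 + star φ * ε) * star σ = star φ + star ε := by
    have h : σ * (1 + star ε * φ) = ε + φ := by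
      rw [hσ, inv_mul_cancel_right₀ (one_add_star_mul_ne_zero hε hφ)]
    simpa [add_comm (star φ)] using congrArg star h
  ext1 i j
  fin_cases i <;> fin_cases j <;> simp [Matrix.mul_apply, Fin.sum_univ_two, upper, lower, add_comm]
end

section
/- Let $M$ and $N$ be $2\times 2$ matrices over the real quaternions and let $z$ be a quaternion. Define the Möbius action of a matrix $A$ on $z$ by $A \cdot z = (A_{00}z + A_{01})(A_{10}z + A_{11})^{-1}$, whenever $A_{10}z + A_{11} \neq 0$. If $N_{10}z + N_{11} \neq 0$ and $(MN)_{10}z + (MN)_{11} \neq 0$, then $M_{10}(N\cdot z) + M_{11} \neq 0$ and $(MN)\cdot z = M\cdot(N\cdot z)$; that is, the quaternionic Möbius action is compatible with matrix multiplication. -/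
open Matrix

/-- The Möbius action of a 2×2 quaternionic matrix on a quaternion. -/
noncomputable def mobius (A : Matrix (Fin 2) (Fin 2) (Quaternion ℝ))
    (z : Quaternion ℝ) : Quaternion ℝ :=
  (A 0 0 * z + A 0 1) * (A 1 0 * z + A 1 1)⁻¹

/-- Applying a row of `M * N` to `(z, 1)` factors through the Möbius action of `N`. -/
theorem mul_row_eq_row_mobius_mul (M N : Matrix (Fin 2) (Fin 2) (Quaternion ℝ))
    (z : Quaternion ℝ) (hN : N 1 0 * z + N 1 1 ≠ 0) (i : Fin 2) :
    (M * N) i 0 * z + (M * N) i 1 =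
      (M i 0 * mobius N z + M i 1) * (N 1 0 * z + N 1 1) := by
  rw [add_mul, mobius, mul_assoc (M i 0), inv_mul_cancel_right₀ hN]
  simp only [Matrix.mul_apply, Fin.sum_univ_two]
  noncomm_ring

/-- The quaternionic Möbius action is compatible with matrix multiplication. -/
theorem stmt_9 (M N : Matrix (Fin 2) (Fin 2) (Quaternion ℝ)) (z : Quaternion ℝ)
    (hN : N 1 0 * z + N 1 1 ≠ 0)
    (hMN : (M * N) 1 0 * z + (M * N) 1 1 ≠ 0) :
    M 1 0 * mobius N z + M 1 1 ≠ 0 ∧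
      mobius (M * N) z = mobius M (mobius N z) := by
  have h := mul_row_eq_row_mobius_mul M N z hN
  refine ⟨left_ne_zero_of_mul (h 1 ▸ hMN), ?_⟩
  rw [mobius, h 0, h 1, _root_.mul_inv_rev, mul_assoc, mul_inv_cancel_left₀ hN]
  rfl
end

section
/- Let $z$ and $\varepsilon$ be purely imaginary real quaternions (zero real part) with $\lVert z \rVert = 1$ and $\lVert \varepsilon \rVert < 1$. Then $1 + \bar{\varepsilon}z \neq 0$ and the quaternion $w = (z+\varepsilon)(1+\bar{\varepsilon}z)^{-1}$ is again purely imaginary with $\lVert w \rVert = 1$; that is, the quaternionic boost map preserves the unit sphere of the imaginary quaternions $\mathrm{Im}\,\mathbb{H} \cong \mathbb{R}^3$. -/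
open Quaternion

theorem Quaternion.re_mul_comm (a b : Quaternion ℝ) : (a * b).re = (b * a).re := by
  simp only [Quaternion.re_mul]
  ring

/-- The quaternionic boost map preserves the unit sphere of imaginary quaternions. -/
theorem stmt_17 (z ε : Quaternion ℝ) (hzim : z.re = 0) (hεim : ε.re = 0)
    (hz : ‖z‖ = 1) (hε : ‖ε‖ < 1) :
    1 + star ε * z ≠ 0 ∧
      ((z + ε) * (1 + star ε * z)⁻¹).re = 0 ∧
      ‖(z + ε) * (1 + star ε * z)⁻¹‖ = 1 := by
  have hstar : star ε = -ε := Quaternion.star_eq_neg.mpr hεim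
  have hzz : z * z = -1 := by
    rw [← sq, Quaternion.sq_eq_neg_normSq.mpr hzim, Quaternion.normSq_eq_norm_mul_self, hz]
    simp
  have hne : 1 + star ε * z ≠ 0 := by
    intro h
    have hnorm := congrArg norm (eq_neg_of_add_eq_zero_left h)
    rw [norm_neg, norm_mul, norm_star, hz, norm_one, mul_one] at hnorm
    exact hε.ne hnorm.symm
  -- The boost is conjugation of `z` by `1 + star ε * z`, since `z * z = -1`.
  have hconj : z + ε = (1 + star ε * z) * z := by
    rw [add_mul, one_mul, mul_assoc, hzz, hstar, neg_mul_neg, mul_one]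
  refine ⟨hne, ?_, ?_⟩
  · rw [hconj, Quaternion.re_mul_comm, inv_mul_cancel_left₀ hne, hzim]
  · rw [hconj, norm_mul, norm_mul, hz, mul_one, norm_inv, mul_inv_cancel₀ (norm_ne_zero_iff.mpr hne)]
end

section
/- Let $\varphi = (1+\sqrt{5})/2$ be the golden ratio and define $f(v) = v - v/(1+\sqrt{1-v^2})$ for $v \in [0,1]$, the discrepancy between a velocity and its menhir. Then $f$ attains its maximum on $[0,1]$ at $v_0 = \varphi^{-1/2}$, i.e. $f(v) \le f(v_0)$ for all $v \in [0,1]$; moreover at this maximizer the menhir cuts the velocity in the golden proportion: $v_0 = \varphi \cdot e_0$ where $e_0 = v_0/(1+\sqrt{1-v_0^2})$. -/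
/-- If `a ^ 2 + a = 1`, then `s ↦ (1 - s) * s ^ 2 / (1 + s)` is at most `a ^ 5`, its value at `a`. -/
theorem one_sub_mul_sq_le_of_sq_add_self {a s : ℝ} (ha0 : 0 ≤ a) (ha : a ^ 2 = 1 - a)
    (hs : 0 ≤ s) : (1 - s) * s ^ 2 ≤ a ^ 5 * (1 + s) := by
  have h : a ^ 5 * (1 + s) - (1 - s) * s ^ 2 = (s - a) ^ 2 * (s + a ^ 3) := by
    linear_combination (s * a ^ 2 * (a + 1) - s ^ 2 * (a - 1)) * ha
  have : 0 ≤ (s - a) ^ 2 * (s + a ^ 3) := by positivity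
  linarith

/-- The discrepancy between a velocity and its menhir is maximized at
`v₀ = φ^(-1/2)`, where `φ` is the golden ratio; at the maximizer the menhir
cuts the velocity in the golden proportion. -/
theorem stmt_18 (φ : ℝ) (hφ : φ = (1 + Real.sqrt 5) / 2)
    (f : ℝ → ℝ) (hf : ∀ v, f v = v - v / (1 + Real.sqrt (1 - v ^ 2)))
    (v₀ : ℝ) (hv₀ : v₀ = φ ^ (-(1 : ℝ) / 2))
    (e₀ : ℝ) (he₀ : e₀ = v₀ / (1 + Real.sqrt (1 - v₀ ^ 2))) :
    (∀ v ∈ Set.Icc (0 : ℝ) 1, f v ≤ f v₀) ∧ v₀ = φ * e₀ := by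
  have h5 : Real.sqrt 5 ^ 2 = 5 := Real.sq_sqrt (by norm_num)
  have hφ1 : 1 < φ := by
    have : (1 : ℝ) < Real.sqrt 5 := Real.lt_sqrt_of_sq_lt (by norm_num)
    linarith
  have hφ2 : φ ^ 2 = φ + 1 := by rw [hφ]; linear_combination h5 / 4
  have hφ0 : 0 < φ := by linarith
  have hv0 : 0 < v₀ := hv₀ ▸ Real.rpow_pos_of_pos hφ0 _
  have hv2 : v₀ ^ 2 = φ - 1 := by
    rw [hv₀, ← Real.rpow_natCast, ← Real.rpow_mul hφ0.le]
    norm_num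
    rw [Real.rpow_neg_one]
    field_simp
    linear_combination -hφ2
  have hs₀ : Real.sqrt (1 - v₀ ^ 2) = φ - 1 := by
    rw [show 1 - v₀ ^ 2 = (φ - 1) ^ 2 by rw [hv2]; linear_combination -hφ2]
    exact Real.sqrt_sq (by linarith)
  have hφs : 1 + (φ - 1) = φ := by ring
  rw [hs₀, hφs] at he₀
  refine ⟨fun v hv => ?_, by rw [he₀]; field_simp⟩
  have hfv₀ : f v₀ = v₀ * (φ - 1) ^ 2 := by
    rw [hf, hs₀, hφs]
    field_simp
    linear_combination (1 - φ) * hφ2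
  rw [hfv₀, hf]
  have hs2 : Real.sqrt (1 - v ^ 2) ^ 2 = 1 - v ^ 2 :=
    Real.sq_sqrt (by nlinarith [hv.1, hv.2])
  have hs := Real.sqrt_nonneg (1 - v ^ 2)
  set s := Real.sqrt (1 - v ^ 2)
  have key := one_sub_mul_sq_le_of_sq_add_self (a := φ - 1) (by linarith)
    (by linear_combination hφ2) hs
  have hfv : v - v / (1 + s) = v * s / (1 + s) := by field_simp; ring
  rw [hfv]
  refine le_of_sq_le_sq ?_ (by positivity)
  have hl : (v * s / (1 + s)) ^ 2 = (1 - s) * s ^ 2 / (1 + s) := by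
    field_simp
    linear_combination s ^ 2 * hs2
  have hr : (v₀ * (φ - 1) ^ 2) ^ 2 = (φ - 1) ^ 5 := by
    rw [mul_pow, hv2]; ring
  rw [hl, hr, div_le_iff₀ (by positivity)]
  exact key
end
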